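/- arXiv:1012.3795 — 3 statements merged into one kernel-verified Lean document; each statement's English description precedes it below -/
import Mathlib

section
/- A matrix β̂ ∈ ℝ^{(p−1)×n} is a minimizer of the TD-Lasso objective F if and only if there exist vectors ẑ_2, …, ẑ_n ∈ ℝ^{p−1} and ŷ_1, …, ŷ_n ∈ ℝ^{p−1} such that: (i) each ẑ_k is a subgradient of the Euclidean norm at β̂_{·,k} − β̂_{·,k−1}, i.e. ẑ_k = (β̂_{·,k} − β̂_{·,k−1})/‖β̂_{·,k} − β̂_{·,k−1}‖₂ if β̂_{·,k} ≠ β̂_{·,k−1} and ‖ẑ_k‖₂ ≤ 1 otherwise; (ii) each ŷ_i is a subgradient of the ℓ₁ norm at β̂_{·,i}, i.e. ŷ_{i,b} = sgn(β̂_{b,i}) if β̂_{b,i} ≠ 0 and ŷ_{i,b} ∈ [−1,1] otherwise; and (iii) setting ẑ_1 = 0 and ẑ_{n+1} = 0, for every k ∈ {1, …, n} one has Σ_{i=k}^n x_{i,\a}(⟨x_{i,\a}, β̂_{·,i}⟩ − x_{i,a}) + λ₁ ẑ_k + λ₂ Σ_{i=k}^n ŷ_i = 0. -/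
open scoped BigOperators

/-- Euclidean (ℓ₂) norm of a vector indexed by a finite type. -/
noncomputable def norm2 {q : Type*} [Fintype q] (v : q → ℝ) : ℝ :=
  Real.sqrt (∑ b, v b ^ 2)

/-- The TD-Lasso objective `F` for node `a`, sample size `n`, data `x` (indexed `1,…,n`),
and penalty parameters `lam1, lam2`.  The argument `β` assigns to each time `i` a
vector of regression coefficients indexed by the nodes `b ≠ a`. -/
noncomputable def tdLoss (p n : ℕ) (x : ℕ → Fin p → ℝ) (a : Fin p)
    (lam1 lam2 : ℝ) (β : ℕ → ({b : Fin p // b ≠ a} → ℝ)) : ℝ :=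
  (∑ i ∈ Finset.Icc 1 n, (x i a - ∑ b, x i b.1 * β i b) ^ 2)
    + 2 * lam1 * ∑ i ∈ Finset.Icc 2 n, norm2 (β i - β (i - 1))
    + 2 * lam2 * ∑ i ∈ Finset.Icc 1 n, ∑ b, |β i b|

section Helpers

variable {q : Type*} [Fintype q]

def SubN (v z : q → ℝ) : Prop :=
  (v ≠ 0 → z = (norm2 v)⁻¹ • v) ∧ (v = 0 → norm2 z ≤ 1)

def SubA (v y : ℝ) : Prop := (v ≠ 0 → y = Real.sign v) ∧ (v = 0 → |y| ≤ 1)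

lemma norm2_nonneg (v : q → ℝ) : 0 ≤ norm2 v := Real.sqrt_nonneg _

lemma norm2_sq (v : q → ℝ) : norm2 v ^ 2 = ∑ b, v b ^ 2 :=
  Real.sq_sqrt (Finset.sum_nonneg fun _ _ => sq_nonneg _)

lemma norm2_zero : norm2 (0 : q → ℝ) = 0 := by simp [norm2]

lemma norm2_eq (v : q → ℝ) : norm2 v = ‖WithLp.toLp 2 v‖ := by
  rw [EuclideanSpace.norm_eq]; simp [norm2]

lemma norm2_pos {v : q → ℝ} (h : v ≠ 0) : 0 < norm2 v := by
  rw [norm2_eq]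
  simpa using h

lemma norm2_smul (t : ℝ) (v : q → ℝ) : norm2 (t • v) = |t| * norm2 v := by
  simp [norm2_eq, norm_smul]

lemma dot_le (z w : q → ℝ) : ∑ b, z b * w b ≤ norm2 z * norm2 w :=
  Real.sum_mul_le_sqrt_mul_sqrt _ _ _

lemma SubN.le {v z : q → ℝ} (h : SubN v z) (w : q → ℝ) :
    norm2 v + ∑ b, z b * (w b - v b) ≤ norm2 w := by
  by_cases hv : v = 0
  · have h1 := h.2 hv
    subst hv
    have := dot_le z w
    have h2 := mul_le_mul_of_nonneg_right h1 (norm2_nonneg w)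
    simp [norm2_zero]
    linarith
  · have h1 := h.1 hv
    have hp := norm2_pos hv
    have e1 : ∑ b, z b * (w b - v b) = (norm2 v)⁻¹ * (∑ b, v b * w b) - (norm2 v)⁻¹ * norm2 v ^ 2 := by
      rw [norm2_sq, Finset.mul_sum, Finset.mul_sum, ← Finset.sum_sub_distrib]
      refine Finset.sum_congr rfl fun b _ => ?_
      rw [h1]; simp; ring
    have h2 := dot_le v w
    have h3 : (norm2 v)⁻¹ * (∑ b, v b * w b) ≤ norm2 w := by
      rw [inv_mul_le_iff₀ hp]; exact h2
    have h4 : (norm2 v)⁻¹ * norm2 v ^ 2 = norm2 v := by field_simp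
    linarith

lemma SubA.le {v y : ℝ} (h : SubA v y) (w : ℝ) : |v| + y * (w - v) ≤ |w| := by
  rcases lt_trichotomy v 0 with hv | hv | hv
  · rw [h.1 hv.ne, Real.sign_of_neg hv, abs_of_neg hv]
    linarith [neg_abs_le w]
  · have := h.2 hv
    subst hv
    have h2 : y * w ≤ |y| * |w| := by rw [← abs_mul]; exact le_abs_self _
    have h3 := mul_le_mul_of_nonneg_right this (abs_nonneg w)
    simp; linarith
  · rw [h.1 hv.ne', Real.sign_of_pos hv, abs_of_pos hv]
    linarith [le_abs_self w]

lemma exists_subN (v d : q → ℝ) : ∃ z, SubN v z ∧ ∃ K, ∀ t : ℝ, 0 ≤ t →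
    norm2 (v + t • d) ≤ norm2 v + t * ∑ b, z b * d b + t ^ 2 * K := by
  by_cases hv : v = 0
  · subst hv
    by_cases hd : d = 0
    · subst hd
      exact ⟨0, ⟨fun h => absurd rfl h, fun _ => by simp [norm2_zero]⟩, 0, fun t _ => by simp⟩
    · have hp := norm2_pos hd
      refine ⟨(norm2 d)⁻¹ • d, ⟨fun h => absurd rfl h, fun _ => ?_⟩, 0, fun t ht => ?_⟩
      · rw [norm2_smul, abs_of_pos (inv_pos.2 hp), inv_mul_cancel₀ hp.ne']
      · have e : ∑ b, ((norm2 d)⁻¹ • d) b * d b = norm2 d := by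
          have : ∑ b, ((norm2 d)⁻¹ • d) b * d b = (norm2 d)⁻¹ * norm2 d ^ 2 := by
            rw [norm2_sq, Finset.mul_sum]
            refine Finset.sum_congr rfl fun b _ => ?_
            simp; ring
          rw [this]; field_simp
        rw [e, zero_add, norm2_smul, abs_of_nonneg ht, norm2_zero]; linarith
  · have hp := norm2_pos hv
    refine ⟨(norm2 v)⁻¹ • v, ⟨fun _ => rfl, fun h => absurd h hv⟩,
      norm2 d ^ 2 * (2 * norm2 v)⁻¹, fun t _ => ?_⟩
    have e1 : norm2 (v + t • d) ^ 2
        = norm2 v ^ 2 + 2 * t * (∑ b, v b * d b) + t ^ 2 * norm2 d ^ 2 := by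
      simp only [norm2_sq, Finset.mul_sum, ← Finset.sum_add_distrib]
      refine Finset.sum_congr rfl fun b _ => ?_
      simp; ring
    have e2 : ∑ b, ((norm2 v)⁻¹ • v) b * d b = (norm2 v)⁻¹ * ∑ b, v b * d b := by
      rw [Finset.mul_sum]
      refine Finset.sum_congr rfl fun b _ => ?_
      simp; ring
    rw [e2]
    have e3 : norm2 v + t * ((norm2 v)⁻¹ * ∑ b, v b * d b) + t ^ 2 * (norm2 d ^ 2 * (2 * norm2 v)⁻¹)
        = (norm2 (v + t • d) ^ 2 + norm2 v ^ 2) / (2 * norm2 v) := by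
      rw [e1]; field_simp; ring
    rw [e3, le_div_iff₀ (by positivity)]
    nlinarith [sq_nonneg (norm2 (v + t • d) - norm2 v)]

lemma exists_subA (v d : ℝ) : ∃ y, SubA v y ∧ ∃ K, ∀ t : ℝ, 0 ≤ t →
    |v + t * d| ≤ |v| + t * (y * d) + t ^ 2 * K := by
  by_cases hv : v = 0
  · subst hv
    refine ⟨Real.sign d, ⟨fun h => absurd rfl h, fun _ => ?_⟩, 0, fun t ht => ?_⟩
    · rcases Real.sign_apply_eq d with h | h | h <;> simp [h]
    · rw [zero_add, abs_mul, abs_of_nonneg ht]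
      rcases lt_trichotomy d 0 with h | h | h
      · rw [Real.sign_of_neg h, abs_of_neg h]; simp
      · simp [h]
      · rw [Real.sign_of_pos h, abs_of_pos h]; simp
  · have hp := abs_pos.2 hv
    refine ⟨Real.sign v, ⟨fun _ => rfl, fun h => absurd h hv⟩, d ^ 2 * (2 * |v|)⁻¹, fun t _ => ?_⟩
    have e0 : |v| * Real.sign v = v := by
      rcases lt_or_gt_of_ne hv with h | h
      · rw [Real.sign_of_neg h, abs_of_neg h]; simp
      · rw [Real.sign_of_pos h, abs_of_pos h]; simp
    have e1 : |v + t * d| ^ 2 = (v + t * d) ^ 2 := sq_abs _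
    have e2 : |v| ^ 2 = v ^ 2 := sq_abs _
    have e3 : |v| + t * (Real.sign v * d) + t ^ 2 * (d ^ 2 * (2 * |v|)⁻¹)
        = (|v + t * d| ^ 2 + |v| ^ 2) / (2 * |v|) := by
      rw [e1, eq_div_iff (by positivity)]
      have : (|v| + t * (Real.sign v * d) + t ^ 2 * (d ^ 2 * (2 * |v|)⁻¹)) * (2 * |v|)
        = 2 * |v| ^ 2 + 2 * t * d * (|v| * Real.sign v) + t ^ 2 * d ^ 2 := by
        field_simp
      rw [this, e0, e2]; ring
    rw [e3, le_div_iff₀ (by positivity)]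
    nlinarith [sq_nonneg (|v + t * d| - |v|)]

lemma subN_set (v : q → ℝ) : IsCompact {z | SubN v z} ∧ Convex ℝ {z | SubN v z} := by
  by_cases hv : v = 0
  · have : {z | SubN v z} =
        (PiLp.continuousLinearEquiv 2 ℝ (fun _ : q => ℝ)) '' Metric.closedBall 0 1 := by
      ext z
      simp only [Set.mem_ofPred_eq, SubN, hv, Set.mem_image, Metric.mem_closedBall, dist_zero_right]
      constructor
      · intro h
        refine ⟨WithLp.toLp 2 z, ?_, rfl⟩
        rw [← norm2_eq]; exact h.2 trivial
      · rintro ⟨w, hw, rfl⟩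
        refine ⟨fun h => absurd rfl h, fun _ => ?_⟩
        rw [norm2_eq]; exact hw
    rw [this]
    refine ⟨(isCompact_closedBall _ _).image (ContinuousLinearEquiv.continuous _), ?_⟩
    exact (convex_closedBall _ _).linear_image
      (PiLp.continuousLinearEquiv 2 ℝ (fun _ : q => ℝ)).toLinearEquiv.toLinearMap
  · have : {z | SubN v z} = {(norm2 v)⁻¹ • v} := by
      ext z; simp [SubN, hv]
    rw [this]
    exact ⟨isCompact_singleton, convex_singleton _⟩

lemma subA_set (v : ℝ) : IsCompact {z | SubA v z} ∧ Convex ℝ {z | SubA v z} := by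
  by_cases hv : v = 0
  · have : {z | SubA v z} = Set.Icc (-1) 1 := by
      ext z; simp [SubA, hv, abs_le]
    rw [this]
    exact ⟨isCompact_Icc, convex_Icc _ _⟩
  · have : {z | SubA v z} = {Real.sign v} := by
      ext z; simp [SubA, hv]
    rw [this]
    exact ⟨isCompact_singleton, convex_singleton _⟩

lemma sum_parts (z d : ℕ → ℝ) (h1 : z 1 = 0) (n : ℕ) (hn : 1 ≤ n) :
    ∑ k ∈ Finset.Icc 2 n, z k * (d k - d (k - 1))
      = ∑ k ∈ Finset.Icc 1 n, (z k - z (k + 1)) * d k + z (n + 1) * d n := by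
  induction n, hn using Nat.le_induction with
  | base => simp [h1]
  | succ m hm ih =>
    rw [Finset.sum_Icc_succ_top (by omega), Finset.sum_Icc_succ_top (by omega), ih]
    simp; ring

lemma abel_iff (n : ℕ) (g z : ℕ → ℝ) (lam : ℝ) (hz : z (n + 1) = 0) :
    (∀ k ∈ Finset.Icc 1 n, (∑ i ∈ Finset.Icc k n, g i) + lam * z k = 0) ↔
    (∀ k ∈ Finset.Icc 1 n, g k + lam * (z k - z (k + 1)) = 0) := by
  have hs : ∀ k, k ≤ n → ∑ i ∈ Finset.Icc k n, g i = g k + ∑ i ∈ Finset.Icc (k + 1) n, g i := by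
    intro k hk
    rw [← Finset.insert_Icc_add_one_left_eq_Icc hk, Finset.sum_insert (by simp)]
  constructor
  · intro h k hk
    rw [Finset.mem_Icc] at hk
    have h1 := h k (Finset.mem_Icc.2 hk)
    rw [hs k hk.2] at h1
    have h2 : (∑ i ∈ Finset.Icc (k + 1) n, g i) + lam * z (k + 1) = 0 := by
      rcases hk.2.eq_or_lt with e | e
      · subst e; simp [hz]
      · exact h (k + 1) (Finset.mem_Icc.2 ⟨by omega, e⟩)
    linarith
  · intro h
    have key : ∀ m k, k + m = n + 1 → 1 ≤ k → (∑ i ∈ Finset.Icc k n, g i) + lam * z k = 0 := by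
      intro m
      induction m with
      | zero => intro k hk _; obtain rfl : k = n + 1 := by omega
                simp [hz]
      | succ m ih =>
        intro k hk h1
        have := ih (k + 1) (by omega) (by omega)
        rw [hs k (by omega)]
        have := h k (Finset.mem_Icc.2 ⟨h1, by omega⟩)
        linarith
    intro k hk
    rw [Finset.mem_Icc] at hk
    exact key (n + 1 - k) k (by omega) hk.1

lemma lin_expand (n : ℕ) (hn : 1 ≤ n) (X : ℕ → q → ℝ) (r : ℕ → ℝ) (z y d : ℕ → q → ℝ)
    (lam1 lam2 : ℝ) (h1 : z 1 = 0) (hz : z (n + 1) = 0) :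
    ∑ i ∈ Finset.Icc 1 n, ∑ b,
        (X i b * r i + lam1 * (z i b - z (i + 1) b) + lam2 * y i b) * d i b
      = ∑ i ∈ Finset.Icc 1 n, r i * ∑ b, X i b * d i b
        + lam1 * ∑ k ∈ Finset.Icc 2 n, ∑ b, z k b * (d k b - d (k - 1) b)
        + lam2 * ∑ i ∈ Finset.Icc 1 n, ∑ b, y i b * d i b := by
  have e : ∑ k ∈ Finset.Icc 2 n, ∑ b, z k b * (d k b - d (k - 1) b)
      = ∑ k ∈ Finset.Icc 1 n, ∑ b, (z k b - z (k + 1) b) * d k b := by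
    rw [Finset.sum_comm, Finset.sum_comm (s := Finset.Icc 1 n)]
    refine Finset.sum_congr rfl fun b _ => ?_
    have := sum_parts (fun k => z k b) (fun k => d k b) (by simp [h1]) n hn
    simpa [hz] using this
  rw [e]
  simp only [Finset.mul_sum, ← Finset.sum_add_distrib]
  refine Finset.sum_congr rfl fun i _ => Finset.sum_congr rfl fun b _ => ?_
  ring

/-- Finite-dimensional alternative: a compact convex set meeting every closed half-space
through the origin contains the origin. -/
lemma zero_mem_of_half {ι : Type*} [Fintype ι] {C : Set (ι → ℝ)} (hc : IsCompact C)
    (hv : Convex ℝ C) (h : ∀ d : ι → ℝ, ∃ c ∈ C, 0 ≤ ∑ i, c i * d i) : (0 : ι → ℝ) ∈ C := by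
  classical
  by_contra h0
  obtain ⟨f, u, hu, hf⟩ := geometric_hahn_banach_point_closed hv hc.isClosed h0
  rw [map_zero] at hu
  obtain ⟨c, hcC, hd⟩ := h (fun i => - f (Pi.single i 1))
  have h1 := hf c hcC
  have h2 : f c = ∑ i, c i * f (Pi.single i 1) := by
    conv_lhs => rw [pi_eq_sum_univ' c]
    rw [map_sum]
    refine Finset.sum_congr rfl fun i _ => ?_
    rw [map_smul, smul_eq_mul]
  simp only [mul_neg, Finset.sum_neg_distrib] at hd
  linarith

end Helpers

/-- KKT characterization of the minimizers of the TD-Lasso objective: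
`β̂` is a minimizer iff there exist subgradient vectors `z` (of the Euclidean norm at the
column differences) and `y` (of the ℓ₁ norm at the columns) with `z 1 = 0`, `z (n+1) = 0`,
satisfying the stationarity equations for every `k ∈ {1,…,n}`. -/
theorem tdLasso_kkt (p n : ℕ) (hp : 2 ≤ p) (hn : 1 ≤ n)
    (x : ℕ → Fin p → ℝ) (a : Fin p)
    (lam1 lam2 : ℝ) (hlam1 : 0 < lam1) (hlam2 : 0 < lam2)
    (βh : ℕ → ({b : Fin p // b ≠ a} → ℝ)) :
    (∀ γ : ℕ → ({b : Fin p // b ≠ a} → ℝ),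
        tdLoss p n x a lam1 lam2 βh ≤ tdLoss p n x a lam1 lam2 γ) ↔
    ∃ z y : ℕ → ({b : Fin p // b ≠ a} → ℝ),
      z 1 = 0 ∧ z (n + 1) = 0 ∧
      (∀ k ∈ Finset.Icc 2 n,
        (βh k ≠ βh (k - 1) →
          z k = (norm2 (βh k - βh (k - 1)))⁻¹ • (βh k - βh (k - 1))) ∧
        (βh k = βh (k - 1) → norm2 (z k) ≤ 1)) ∧
      (∀ i ∈ Finset.Icc 1 n, ∀ b : {b : Fin p // b ≠ a},
        (βh i b ≠ 0 → y i b = Real.sign (βh i b)) ∧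
        (βh i b = 0 → |y i b| ≤ 1)) ∧
      (∀ k ∈ Finset.Icc 1 n, ∀ b : {b : Fin p // b ≠ a},
        (∑ i ∈ Finset.Icc k n, x i b.1 * ((∑ c, x i c.1 * βh i c) - x i a))
          + lam1 * z k b + lam2 * ∑ i ∈ Finset.Icc k n, y i b = 0) := by

  have hcast : ∀ z y : ℕ → ({b : Fin p // b ≠ a} → ℝ), z (n + 1) = 0 →
      ((∀ k ∈ Finset.Icc 1 n, ∀ b : {b : Fin p // b ≠ a},
        (∑ i ∈ Finset.Icc k n, x i b.1 * ((∑ c, x i c.1 * βh i c) - x i a))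
          + lam1 * z k b + lam2 * ∑ i ∈ Finset.Icc k n, y i b = 0) ↔
      (∀ k ∈ Finset.Icc 1 n, ∀ b : {b : Fin p // b ≠ a},
        x k b.1 * ((∑ c, x k c.1 * βh k c) - x k a) + lam1 * (z k b - z (k + 1) b)
          + lam2 * y k b = 0)) := by
    intro z y hz
    have key := fun b : {b : Fin p // b ≠ a} => abel_iff n
      (fun i => x i b.1 * ((∑ c, x i c.1 * βh i c) - x i a) + lam2 * y i b)
      (fun k => z k b) lam1 (by simp [hz])
    constructor
    · intro h k hk b
      have := (key b).1 (fun k hk => by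
        rw [Finset.sum_add_distrib, ← Finset.mul_sum]
        linarith [h k hk b]) k hk
      linarith
    · intro h k hk b
      have := (key b).2 (fun k hk => by
        linarith [h k hk b]) k hk
      rw [Finset.sum_add_distrib, ← Finset.mul_sum] at this
      linarith
  constructor
  · intro hmin
    set r : ℕ → ℝ := fun i => (∑ c : {b : Fin p // b ≠ a}, x i c.1 * βh i c) - x i a with hr
    let Z : ℕ → Set ({b : Fin p // b ≠ a} → ℝ) := fun k =>
      if k ∈ Finset.Icc 2 n then {z | SubN (βh k - βh (k - 1)) z} else {0}
    let Y : ℕ → Set ({b : Fin p // b ≠ a} → ℝ) := fun i =>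
      if i ∈ Finset.Icc 1 n then Set.pi Set.univ (fun b => {y | SubA (βh i b) y}) else {0}
    have hZ : ∀ k, IsCompact (Z k) ∧ Convex ℝ (Z k) := by
      intro k
      by_cases hk : k ∈ Finset.Icc 2 n
      · simp only [Z, if_pos hk]; exact subN_set _
      · simp only [Z, if_neg hk]; exact ⟨isCompact_singleton, convex_singleton _⟩
    have hY : ∀ k, IsCompact (Y k) ∧ Convex ℝ (Y k) := by
      intro k
      by_cases hk : k ∈ Finset.Icc 1 n
      · simp only [Y, if_pos hk]
        exact ⟨isCompact_univ_pi fun b => (subA_set _).1, convex_pi fun b _ => (subA_set _).2⟩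
      · simp only [Y, if_neg hk]; exact ⟨isCompact_singleton, convex_singleton _⟩
    let S : Set ((ℕ → ({b : Fin p // b ≠ a} → ℝ)) × (ℕ → ({b : Fin p // b ≠ a} → ℝ))) :=
      Set.pi Set.univ Z ×ˢ Set.pi Set.univ Y
    have hSc : IsCompact S :=
      (isCompact_univ_pi fun k => (hZ k).1).prod (isCompact_univ_pi fun k => (hY k).1)
    have hSv : Convex ℝ S :=
      (convex_pi fun k _ => (hZ k).2).prod (convex_pi fun k _ => (hY k).2)
    have hS1 : ∀ w ∈ S, w.1 1 = 0 ∧ w.1 (n + 1) = 0 := by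
      intro w hw
      have h1 := hw.1 1 trivial
      have h2 := hw.1 (n + 1) trivial
      simp only [Z] at h1 h2
      rw [if_neg (by simp)] at h1 h2
      exact ⟨h1, h2⟩
    let A : ((ℕ → ({b : Fin p // b ≠ a} → ℝ)) × (ℕ → ({b : Fin p // b ≠ a} → ℝ))) →
        ({i // i ∈ Finset.Icc 1 n} × {b : Fin p // b ≠ a} → ℝ) := fun w j =>
      x j.1 j.2 * r j.1 + lam1 * (w.1 j.1 j.2 - w.1 (j.1 + 1) j.2) + lam2 * w.2 j.1 j.2
    have hA : Continuous A := by
      simp only [A]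
      fun_prop
    have hC : IsCompact (A '' S) := hSc.image hA
    have hCv : Convex ℝ (A '' S) := by
      rintro _ ⟨u, hu, rfl⟩ _ ⟨w, hw, rfl⟩ s t hs ht hst
      refine ⟨s • u + t • w, hSv hu hw hs ht hst, ?_⟩
      ext j
      simp only [A, Prod.fst_add, Prod.snd_add, Prod.smul_fst, Prod.smul_snd, Pi.add_apply,
        Pi.smul_apply, smul_eq_mul]
      linear_combination (-(x j.1 j.2 * r j.1)) * hst
    have h0 : (0 : {i // i ∈ Finset.Icc 1 n} × {b : Fin p // b ≠ a} → ℝ) ∈ A '' S := by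
      refine zero_mem_of_half hC hCv fun d' => ?_
      let d : ℕ → ({b : Fin p // b ≠ a} → ℝ) := fun i b =>
        if hi : i ∈ Finset.Icc 1 n then d' (⟨i, hi⟩, b) else 0
      choose zz hzz Kz hKz using fun k => exists_subN (βh k - βh (k - 1)) (d k - d (k - 1))
      choose yy hyy Ky hKy using fun i b => exists_subA (βh i b) (d i b)
      let z : ℕ → ({b : Fin p // b ≠ a} → ℝ) := fun k => if k ∈ Finset.Icc 2 n then zz k else 0
      let y : ℕ → ({b : Fin p // b ≠ a} → ℝ) := fun k => if k ∈ Finset.Icc 1 n then yy k else 0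
      have hzS : (z, y) ∈ S := by
        refine ⟨fun k _ => ?_, fun k _ => ?_⟩
        · by_cases hk : k ∈ Finset.Icc 2 n
          · simp only [Z, z, if_pos hk]; exact hzz k
          · simp only [Z, z, if_neg hk]; rfl
        · by_cases hk : k ∈ Finset.Icc 1 n
          · simp only [Y, y, if_pos hk]; exact fun b _ => hyy k b
          · simp only [Y, y, if_neg hk]; rfl
      refine ⟨A (z, y), ⟨_, hzS, rfl⟩, ?_⟩
      have hsum : ∑ j, A (z, y) j * d' j = ∑ i ∈ Finset.Icc 1 n, ∑ b : {b : Fin p // b ≠ a},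
          (x i b.1 * r i + lam1 * (z i b - z (i + 1) b) + lam2 * y i b) * d i b := by
        rw [Fintype.sum_prod_type, ← Finset.sum_coe_sort (Finset.Icc 1 n)]
        refine Finset.sum_congr rfl fun i _ => Finset.sum_congr rfl fun b _ => ?_
        have : d i b = d' (i, b) := by simp only [d]; rw [dif_pos i.2]
        rw [this]
      rw [hsum, lin_expand n hn (fun i b => x i b.1) r z y d lam1 lam2 (hS1 _ hzS).1 (hS1 _ hzS).2]
      set s : ℕ → ℝ := fun i => ∑ b : {b : Fin p // b ≠ a}, x i b.1 * d i b with hs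
      set D := ∑ i ∈ Finset.Icc 1 n, r i * s i
        + lam1 * ∑ k ∈ Finset.Icc 2 n, ∑ b, z k b * (d k b - d (k - 1) b)
        + lam2 * ∑ i ∈ Finset.Icc 1 n, ∑ b, y i b * d i b with hD
      set K := ∑ i ∈ Finset.Icc 1 n, s i ^ 2 + 2 * lam1 * ∑ k ∈ Finset.Icc 2 n, Kz k
        + 2 * lam2 * ∑ i ∈ Finset.Icc 1 n, ∑ b, Ky i b with hK
      have main : ∀ t : ℝ, 0 < t → 0 ≤ 2 * D + t * K := by
        intro t ht
        have hm := hmin (fun i => βh i + t • d i)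
        have b1 : ∑ i ∈ Finset.Icc 1 n,
            (x i a - ∑ b : {b : Fin p // b ≠ a}, x i b.1 * (βh i + t • d i) b) ^ 2
            = ∑ i ∈ Finset.Icc 1 n, (x i a - ∑ b : {b : Fin p // b ≠ a}, x i b.1 * βh i b) ^ 2
              + 2 * t * ∑ i ∈ Finset.Icc 1 n, r i * s i + t ^ 2 * ∑ i ∈ Finset.Icc 1 n, s i ^ 2 := by
          rw [Finset.mul_sum, Finset.mul_sum, ← Finset.sum_add_distrib, ← Finset.sum_add_distrib]
          refine Finset.sum_congr rfl fun i _ => ?_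
          have : ∑ b : {b : Fin p // b ≠ a}, x i b.1 * (βh i + t • d i) b
              = ∑ b : {b : Fin p // b ≠ a}, x i b.1 * βh i b + t * s i := by
            simp only [hs, Finset.mul_sum, ← Finset.sum_add_distrib]
            refine Finset.sum_congr rfl fun b _ => ?_
            simp; ring
          rw [this]; simp only [hr]; ring
        have b2 : ∑ k ∈ Finset.Icc 2 n, norm2 ((βh k + t • d k) - (βh (k - 1) + t • d (k - 1)))
            ≤ ∑ k ∈ Finset.Icc 2 n, norm2 (βh k - βh (k - 1))
              + t * ∑ k ∈ Finset.Icc 2 n, ∑ b, z k b * (d k b - d (k - 1) b)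
              + t ^ 2 * ∑ k ∈ Finset.Icc 2 n, Kz k := by
          rw [Finset.mul_sum, Finset.mul_sum, ← Finset.sum_add_distrib, ← Finset.sum_add_distrib]
          refine Finset.sum_le_sum fun k hk => ?_
          have h := hKz k t ht.le
          have e1 : (βh k + t • d k) - (βh (k - 1) + t • d (k - 1))
              = βh k - βh (k - 1) + t • (d k - d (k - 1)) := by rw [smul_sub]; abel
          have e2 : z k = zz k := if_pos hk
          rw [e1, e2]
          simpa using h
        have b3 : ∑ i ∈ Finset.Icc 1 n, ∑ b, |(βh i + t • d i) b|
            ≤ ∑ i ∈ Finset.Icc 1 n, ∑ b, |βh i b|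
              + t * ∑ i ∈ Finset.Icc 1 n, ∑ b, y i b * d i b
              + t ^ 2 * ∑ i ∈ Finset.Icc 1 n, ∑ b, Ky i b := by
          simp only [Finset.mul_sum, ← Finset.sum_add_distrib]
          refine Finset.sum_le_sum fun k hk => Finset.sum_le_sum fun b _ => ?_
          have h := hKy k b t ht.le
          have e2 : y k = yy k := if_pos hk
          rw [e2]
          simpa using h
        have b2' := mul_le_mul_of_nonneg_left b2 (by positivity : 0 ≤ 2 * lam1)
        have b3' := mul_le_mul_of_nonneg_left b3 (by positivity : 0 ≤ 2 * lam2)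
        simp only [tdLoss] at hm
        rw [b1] at hm
        have : 0 ≤ t * (2 * D + t * K) := by
          rw [hD, hK]
          linarith
        exact nonneg_of_mul_nonneg_right this ht
      by_contra hneg
      push Not at hneg
      have hpos : 0 < |K| + 1 := by positivity
      have h1 := main (-D / (|K| + 1)) (div_pos (by linarith) hpos)
      have h2 : -D / (|K| + 1) * K ≤ -D := by
        rw [div_mul_eq_mul_div, div_le_iff₀ hpos]
        exact mul_le_mul_of_nonneg_left (by linarith [le_abs_self K]) (by linarith)
      linarith
    obtain ⟨⟨z, y⟩, hw, hA0⟩ := h0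
    obtain ⟨hz1, hzn⟩ := hS1 _ hw
    refine ⟨z, y, hz1, hzn, fun k hk => ?_, fun i hi b => ?_, (hcast z y hzn).2 fun k hk b => ?_⟩
    · have h : SubN (βh k - βh (k - 1)) (z k) := by
        have := hw.1 k trivial
        simp only [Z, if_pos hk] at this
        exact this
      exact ⟨fun hne => h.1 (sub_ne_zero.2 hne), fun he => h.2 (sub_eq_zero.2 he)⟩
    · have h : SubA (βh i b) (y i b) := by
        have := hw.2 i trivial
        simp only [Y, if_pos hi] at this
        exact this b trivial
      exact h
    · exact congrFun hA0 (⟨k, hk⟩, b)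
  · rintro ⟨z, y, hz1, hzn, hz, hy, hst⟩ γ
    rw [hcast z y hzn] at hst
    have hlin := lin_expand n hn (fun i (b : {b : Fin p // b ≠ a}) => x i b.1)
      (fun i => (∑ c : {b : Fin p // b ≠ a}, x i c.1 * βh i c) - x i a) z y
      (fun i => γ i - βh i) lam1 lam2 hz1 hzn
    have hL0 : ∑ i ∈ Finset.Icc 1 n, ∑ b : {b : Fin p // b ≠ a},
        (x i b.1 * ((∑ c : {b : Fin p // b ≠ a}, x i c.1 * βh i c) - x i a)
          + lam1 * (z i b - z (i + 1) b) + lam2 * y i b) * (γ i - βh i) b = 0 :=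
      Finset.sum_eq_zero fun i hi => Finset.sum_eq_zero fun b _ => by rw [hst i hi b, zero_mul]
    rw [hL0] at hlin
    have b1 : ∑ i ∈ Finset.Icc 1 n, (x i a - ∑ b : {b : Fin p // b ≠ a}, x i b.1 * βh i b) ^ 2
        + 2 * ∑ i ∈ Finset.Icc 1 n, ((∑ c : {b : Fin p // b ≠ a}, x i c.1 * βh i c) - x i a)
          * ∑ b : {b : Fin p // b ≠ a}, x i b.1 * (γ i - βh i) b
        ≤ ∑ i ∈ Finset.Icc 1 n, (x i a - ∑ b : {b : Fin p // b ≠ a}, x i b.1 * γ i b) ^ 2 := by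
      rw [Finset.mul_sum, ← Finset.sum_add_distrib]
      refine Finset.sum_le_sum fun i _ => ?_
      have : ∑ b : {b : Fin p // b ≠ a}, x i b.1 * (γ i - βh i) b
          = ∑ b : {b : Fin p // b ≠ a}, x i b.1 * γ i b
            - ∑ b : {b : Fin p // b ≠ a}, x i b.1 * βh i b := by
        simp [mul_sub, Finset.sum_sub_distrib]
      rw [this]
      nlinarith [sq_nonneg (∑ b : {b : Fin p // b ≠ a}, x i b.1 * γ i b
            - ∑ b : {b : Fin p // b ≠ a}, x i b.1 * βh i b)]
    have b2 : ∑ k ∈ Finset.Icc 2 n, norm2 (βh k - βh (k - 1))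
        + ∑ k ∈ Finset.Icc 2 n, ∑ b, z k b * ((γ k - βh k) b - (γ (k - 1) - βh (k - 1)) b)
        ≤ ∑ k ∈ Finset.Icc 2 n, norm2 (γ k - γ (k - 1)) := by
      rw [← Finset.sum_add_distrib]
      refine Finset.sum_le_sum fun k hk => ?_
      have h : SubN (βh k - βh (k - 1)) (z k) :=
        ⟨fun h => (hz k hk).1 (sub_ne_zero.1 h), fun h => (hz k hk).2 (sub_eq_zero.1 h)⟩
      have e : ∑ b, z k b * ((γ k - βh k) b - (γ (k - 1) - βh (k - 1)) b)
          = ∑ b, z k b * ((γ k - γ (k - 1)) b - (βh k - βh (k - 1)) b) := by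
        refine Finset.sum_congr rfl fun b _ => ?_
        simp only [Pi.sub_apply]; ring
      rw [e]
      exact h.le (γ k - γ (k - 1))
    have b3 : ∑ i ∈ Finset.Icc 1 n, ∑ b, |βh i b|
        + ∑ i ∈ Finset.Icc 1 n, ∑ b, y i b * (γ i - βh i) b
        ≤ ∑ i ∈ Finset.Icc 1 n, ∑ b, |γ i b| := by
      simp only [← Finset.sum_add_distrib]
      exact Finset.sum_le_sum fun i hi => Finset.sum_le_sum fun b _ =>
        SubA.le (v := βh i b) (y := y i b) (hy i hi b) (γ i b)
    have b2' := mul_le_mul_of_nonneg_left b2 (by positivity : 0 ≤ 2 * lam1)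
    have b3' := mul_le_mul_of_nonneg_left b3 (by positivity : 0 ≤ 2 * lam2)
    simp only [tdLoss]
    linarith
end

section
/- Let β̂ ∈ ℝ^{(p−1)×n} be any minimizer of the TD-Lasso objective F. Then for all integers 1 ≤ k₁ < k₂ ≤ n, the fitted-residual partial sums satisfy ‖Σ_{i=k₁}^{k₂−1} x_{i,\a}(⟨x_{i,\a}, β̂_{·,i}⟩ − x_{i,a})‖₂ ≤ 2λ₁ + (k₂ − k₁)·√(p−1)·λ₂. -/
open scoped BigOperators

lemma norm2_eq_norm {q : Type*} [Fintype q] (v : q → ℝ) : norm2 v = ‖WithLp.toLp 2 v‖ := by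
  simp [norm2, EuclideanSpace.norm_eq]

lemma norm2_add_smul_le {q : Type*} [Fintype q] (v w : q → ℝ) (c : ℝ) :
    norm2 (v + c • w) ≤ norm2 v + |c| * norm2 w := by
  simp only [norm2_eq_norm, WithLp.toLp_add, WithLp.toLp_smul]
  refine (norm_add_le _ _).trans ?_
  rw [norm_smul, Real.norm_eq_abs]

lemma l1_le_norm2 {q : Type*} [Fintype q] (v : q → ℝ) :
    ∑ b, |v b| ≤ Real.sqrt (Fintype.card q) * norm2 v := by
  unfold norm2
  rw [← Real.sqrt_mul (by positivity)]
  apply Real.le_sqrt_of_sq_le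
  have h := sq_sum_le_card_mul_sum_sq (s := (Finset.univ : Finset q)) (f := fun b => |v b|)
  simpa [sq_abs] using h

lemma le_of_forall_small (A B C : ℝ) (h : ∀ t : ℝ, 0 < t → A ≤ B + t * C) : A ≤ B := by
  by_contra! hlt
  have hC : 0 < |C| + 1 := by positivity
  have h1 := h ((A - B) / (2 * (|C| + 1))) (by apply div_pos <;> linarith)
  have h2 : (A - B) / (2 * (|C| + 1)) * C ≤ (A - B) / (2 * (|C| + 1)) * (|C| + 1) := by
    apply mul_le_mul_of_nonneg_left
    · linarith [le_abs_self C]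
    · apply div_nonneg <;> linarith
  have h3 : (A - B) / (2 * (|C| + 1)) * (|C| + 1) = (A - B) / 2 := by
    field_simp
  linarith

/-- For any minimizer `β̂` of the TD-Lasso objective and any `1 ≤ k₁ < k₂ ≤ n`, the
fitted-residual partial sums satisfy
`‖Σ_{i=k₁}^{k₂−1} x_{i,\a}(⟨x_{i,\a}, β̂_{·,i}⟩ − x_{i,a})‖₂ ≤ 2λ₁ + (k₂−k₁)√(p−1) λ₂`. -/
theorem tdLasso_partial_sum_bound (p n : ℕ) (hp : 2 ≤ p) (hn : 1 ≤ n)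
    (x : ℕ → Fin p → ℝ) (a : Fin p)
    (lam1 lam2 : ℝ) (hlam1 : 0 < lam1) (hlam2 : 0 < lam2)
    (βh : ℕ → ({b : Fin p // b ≠ a} → ℝ))
    (hmin : ∀ γ : ℕ → ({b : Fin p // b ≠ a} → ℝ),
      tdLoss p n x a lam1 lam2 βh ≤ tdLoss p n x a lam1 lam2 γ) :
    ∀ k₁ k₂ : ℕ, 1 ≤ k₁ → k₁ < k₂ → k₂ ≤ n →
      norm2 (fun b : {b : Fin p // b ≠ a} =>
          ∑ i ∈ Finset.Icc k₁ (k₂ - 1), x i b.1 * ((∑ c, x i c.1 * βh i c) - x i a))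
        ≤ 2 * lam1 + ((k₂ : ℝ) - (k₁ : ℝ)) * Real.sqrt ((p : ℝ) - 1) * lam2 := by
  intro k₁ k₂ hk1 hk12 hk2
  set S : {b : Fin p // b ≠ a} → ℝ := fun b =>
    ∑ i ∈ Finset.Icc k₁ (k₂ - 1), x i b.1 * ((∑ c, x i c.1 * βh i c) - x i a) with hS
  set N := norm2 S with hN
  have hN0 : 0 ≤ N := Real.sqrt_nonneg _
  have hNsq : N ^ 2 = ∑ b, S b ^ 2 := Real.sq_sqrt (Finset.sum_nonneg fun b _ => sq_nonneg _)
  set u : ℕ → ℝ := fun i => if i ∈ Finset.Icc k₁ (k₂ - 1) then 1 else 0 with hu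
  have hu0 : ∀ i, 0 ≤ u i := fun i => by simp only [hu]; split_ifs <;> norm_num
  have hfilt : (Finset.Icc 1 n).filter (fun i => i ∈ Finset.Icc k₁ (k₂ - 1))
      = Finset.Icc k₁ (k₂ - 1) := by
    ext i
    simp only [Finset.mem_filter, Finset.mem_Icc]
    omega
  have husum : ∀ f : ℕ → ℝ, ∑ i ∈ Finset.Icc 1 n, u i * f i
      = ∑ i ∈ Finset.Icc k₁ (k₂ - 1), f i := by
    intro f
    rw [← hfilt, Finset.sum_filter]
    apply Finset.sum_congr rfl
    intro i _
    simp only [hu]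
    split_ifs <;> simp
  set d : ℕ → ℝ := fun i => ∑ b : {b : Fin p // b ≠ a}, x i b.1 * S b with hd
  set e : ℕ → ℝ := fun i => (∑ c : {b : Fin p // b ≠ a}, x i c.1 * βh i c) - x i a with he
  have hed : ∑ i ∈ Finset.Icc 1 n, u i * (e i * d i) = N ^ 2 := by
    rw [husum, hNsq]
    simp only [hd, Finset.mul_sum]
    rw [Finset.sum_comm]
    apply Finset.sum_congr rfl
    intro b _
    rw [sq]
    nth_rewrite 2 [hS]
    simp only
    rw [Finset.mul_sum]
    apply Finset.sum_congr rfl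
    intro i _
    simp only [he]
    ring
  set C := ∑ i ∈ Finset.Icc 1 n, (u i * d i) ^ 2 with hC
  set L := ∑ b, |S b| with hL
  have hcard : ((Fintype.card {b : Fin p // b ≠ a} : ℕ) : ℝ) = (p : ℝ) - 1 := by
    have : Fintype.card {b : Fin p // b ≠ a} = p - 1 := by
      simp
    rw [this, Nat.cast_sub (by omega)]
    simp
  have hLN : L ≤ Real.sqrt ((p : ℝ) - 1) * N := by
    rw [← hcard]
    exact l1_le_norm2 S
  have hm : (0 : ℝ) < (k₂ : ℝ) - k₁ := by
    have : (k₁ : ℝ) < k₂ := by exact_mod_cast hk12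
    linarith
  have key : ∀ t : ℝ, 0 < t →
      2 * N ^ 2 ≤ (4 * lam1 * N + 2 * lam2 * (((k₂ : ℝ) - k₁) * L)) + t * C := by
    intro t ht
    have h := hmin (fun i => βh i + (-(t * u i)) • S)
    unfold tdLoss at h
    have h1 : ∑ i ∈ Finset.Icc 1 n,
        (x i a - ∑ b : {b : Fin p // b ≠ a}, x i b.1 * (βh i + (-(t * u i)) • S) b) ^ 2
        = ∑ i ∈ Finset.Icc 1 n, (x i a - ∑ b : {b : Fin p // b ≠ a}, x i b.1 * βh i b) ^ 2
          - 2 * t * N ^ 2 + t ^ 2 * C := by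
      rw [← hed, hC, Finset.mul_sum, Finset.mul_sum, ← Finset.sum_sub_distrib,
        ← Finset.sum_add_distrib]
      apply Finset.sum_congr rfl
      intro i _
      have : ∑ b : {b : Fin p // b ≠ a}, x i b.1 * (βh i + (-(t * u i)) • S) b
          = (∑ b : {b : Fin p // b ≠ a}, x i b.1 * βh i b) - t * u i * d i := by
        simp only [hd, Finset.mul_sum, ← Finset.sum_sub_distrib]
        apply Finset.sum_congr rfl
        intro b _
        simp only [Pi.add_apply, Pi.smul_apply, smul_eq_mul]
        ring
      rw [this]
      simp only [he]
      ring
    have h2 : ∑ i ∈ Finset.Icc 2 n,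
        norm2 ((βh i + (-(t * u i)) • S) - (βh (i - 1) + (-(t * u (i - 1))) • S))
        ≤ ∑ i ∈ Finset.Icc 2 n, norm2 (βh i - βh (i - 1)) + 2 * (t * N) := by
      have hb : ∀ i ∈ Finset.Icc 2 n,
          norm2 ((βh i + (-(t * u i)) • S) - (βh (i - 1) + (-(t * u (i - 1))) • S))
          ≤ norm2 (βh i - βh (i - 1)) +
            ((if i = k₁ then t * N else 0) + (if i = k₂ then t * N else 0)) := by
        intro i hi
        rw [Finset.mem_Icc] at hi
        have e1 : (βh i + (-(t * u i)) • S) - (βh (i - 1) + (-(t * u (i - 1))) • S)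
            = (βh i - βh (i - 1)) + (t * (u (i - 1) - u i)) • S := by
          ext b
          simp only [Pi.add_apply, Pi.sub_apply, Pi.smul_apply, smul_eq_mul]
          ring
        rw [e1]
        refine (norm2_add_smul_le _ _ _).trans ?_
        rw [abs_mul, abs_of_pos ht, mul_assoc]
        have e2 : |u (i - 1) - u i| ≤ (if i = k₁ then 1 else 0) + (if i = k₂ then 1 else 0) := by
          simp only [hu, Finset.mem_Icc]
          split_ifs <;> first | omega | norm_num
        have e3 : t * (|u (i - 1) - u i| * N)
            ≤ t * (((if i = k₁ then 1 else 0) + (if i = k₂ then 1 else 0)) * N) := by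
          gcongr
        refine add_le_add le_rfl (e3.trans (le_of_eq ?_))
        split_ifs <;> ring
      refine (Finset.sum_le_sum hb).trans ?_
      rw [Finset.sum_add_distrib, Finset.sum_add_distrib, Finset.sum_ite_eq', Finset.sum_ite_eq']
      have : 0 ≤ t * N := by positivity
      split_ifs <;> linarith
    have h3 : ∑ i ∈ Finset.Icc 1 n, ∑ b, |(βh i + (-(t * u i)) • S) b|
        ≤ ∑ i ∈ Finset.Icc 1 n, ∑ b, |βh i b| + t * (((k₂ : ℝ) - k₁) * L) := by
      have e1 : ((k₂ : ℝ) - k₁) * L = ∑ i ∈ Finset.Icc 1 n, u i * L := by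
        rw [husum, Finset.sum_const, Nat.card_Icc, nsmul_eq_mul]
        have : k₂ - 1 + 1 - k₁ = k₂ - k₁ := by omega
        rw [this, Nat.cast_sub hk12.le]
      rw [e1, Finset.mul_sum, ← Finset.sum_add_distrib]
      apply Finset.sum_le_sum
      intro i _
      rw [hL, Finset.mul_sum, Finset.mul_sum, ← Finset.sum_add_distrib]
      apply Finset.sum_le_sum
      intro b _
      simp only [Pi.add_apply, Pi.smul_apply, smul_eq_mul]
      refine (abs_add_le _ _).trans ?_
      rw [abs_mul, abs_neg, abs_of_nonneg (mul_nonneg ht.le (hu0 i)), mul_assoc]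
    have h2' := mul_le_mul_of_nonneg_left h2 (by positivity : 0 ≤ 2 * lam1)
    have h3' := mul_le_mul_of_nonneg_left h3 (by positivity : 0 ≤ 2 * lam2)
    rw [h1] at h
    have h4 : t * (2 * N ^ 2)
        ≤ t * ((4 * lam1 * N + 2 * lam2 * (((k₂ : ℝ) - k₁) * L)) + t * C) := by
      linarith
    exact le_of_mul_le_mul_left h4 ht
  have hfin := le_of_forall_small _ _ _ key
  rcases hN0.eq_or_lt with h0 | h0
  · rw [← h0]
    positivity
  · have h5 : 2 * lam2 * (((k₂ : ℝ) - k₁) * L)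
        ≤ 2 * lam2 * (((k₂ : ℝ) - k₁) * (Real.sqrt ((p : ℝ) - 1) * N)) := by
      gcongr
    have h6 : N * N ≤ N * (2 * lam1 + ((k₂ : ℝ) - k₁) * Real.sqrt ((p : ℝ) - 1) * lam2) := by
      linarith
    exact le_of_mul_le_mul_left h6 h0
end

section
/- Let β̂ be a minimizer of the TD-Lasso objective F with estimated boundary set T̂, and let ẑ_2,…,ẑ_n and ŷ_1,…,ŷ_n be subgradient vectors certifying its optimality (ẑ_k a subgradient of the Euclidean norm at β̂_{·,k} − β̂_{·,k−1}, ŷ_i a subgradient of the ℓ₁ norm at β̂_{·,i}, satisfying the stationarity equations Σ_{i=k}^n x_{i,\a}(⟨x_{i,\a}, β̂_{·,i}⟩ − x_{i,a}) + λ₁ ẑ_k + λ₂ Σ_{i=k}^n ŷ_i = 0 for all k ∈ {1,…,n}, with ẑ_1 = ẑ_{n+1} = 0). Suppose that for every i ∈ {1,…,n} and every b with β̂_{b,i} = 0 one has the strict inequality |ŷ_{i,b}| < 1. Then every minimizer β̃ of F whose estimated boundary set equals T̂ satisfies β̃_{b,i} = 0 for all i and all b with β̂_{b,i} = 0. -/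
open scoped BigOperators

/-- The estimated boundary set `T̂ = {1} ∪ {i ∈ {2,…,n} : β_{·,i} ≠ β_{·,i−1}} ∪ {n+1}`. -/
def boundarySet (p n : ℕ) (a : Fin p) (β : ℕ → ({b : Fin p // b ≠ a} → ℝ)) : Set ℕ :=
  {1} ∪ {i : ℕ | 2 ≤ i ∧ i ≤ n ∧ β i ≠ β (i - 1)} ∪ {n + 1}

theorem aux_abel (z d : ℕ → ℝ) (m : ℕ) (hm : 1 ≤ m) :
    ∑ k ∈ Finset.Icc 1 m, (z k - z (k + 1)) * d k
      = ∑ k ∈ Finset.Icc 2 m, z k * (d k - d (k - 1)) + z 1 * d 1 - z (m + 1) * d m := by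
  induction m, hm using Nat.le_induction with
  | base => simp; ring
  | succ m hm ih =>
    rw [Finset.sum_Icc_succ_top (by omega), Finset.sum_Icc_succ_top (by omega), ih]
    simp only [Nat.add_sub_cancel]
    ring

theorem aux_cs {q : Type*} [Fintype q] (z v : q → ℝ) (hz : norm2 z ≤ 1) :
    ∑ b, z b * v b ≤ norm2 v := by
  have h := Real.sum_mul_le_sqrt_mul_sqrt Finset.univ z v
  have h0 : 0 ≤ norm2 v := Real.sqrt_nonneg _
  have h1 : norm2 z * norm2 v ≤ norm2 v := by nlinarith
  exact h.trans h1

theorem aux_normalized {q : Type*} [Fintype q] (w : q → ℝ) (hw : w ≠ 0) :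
    norm2 ((norm2 w)⁻¹ • w) ≤ 1 ∧ ∑ b, ((norm2 w)⁻¹ • w) b * w b = norm2 w := by
  have hpos : 0 < ∑ b, w b ^ 2 := by
    obtain ⟨b, hb⟩ := Function.ne_iff.mp hw
    have hb' : w b ≠ 0 := hb
    exact Finset.sum_pos' (fun _ _ => sq_nonneg _) ⟨b, Finset.mem_univ _, by positivity⟩
  have hn : 0 < norm2 w := Real.sqrt_pos.mpr hpos
  have hsq : norm2 w ^ 2 = ∑ b, w b ^ 2 := Real.sq_sqrt hpos.le
  constructor
  · have : ∑ b, ((norm2 w)⁻¹ • w) b ^ 2 = 1 := by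
      simp only [Pi.smul_apply, smul_eq_mul, mul_pow]
      rw [← Finset.mul_sum, ← hsq]
      field_simp
    unfold norm2 at this ⊢
    rw [this]; simp
  · simp only [Pi.smul_apply, smul_eq_mul, mul_assoc]
    rw [← Finset.mul_sum]
    have : ∑ b, w b * w b = norm2 w ^ 2 := by
      rw [hsq]; exact Finset.sum_congr rfl fun _ _ => by ring
    rw [this]; field_simp

/-- Uniqueness of the sparsity pattern among minimizers with the same boundary set:
if the ℓ₁-subgradient certificate `y` of a minimizer `β̂` is strictly dual feasible
(`|ŷ_{i,b}| < 1` whenever `β̂_{b,i} = 0`), then every minimizer `β̃` with the same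
estimated boundary set vanishes wherever `β̂` vanishes. -/
theorem tdLasso_unique_pattern (p n : ℕ) (hp : 2 ≤ p) (hn : 1 ≤ n)
    (x : ℕ → Fin p → ℝ) (a : Fin p)
    (lam1 lam2 : ℝ) (hlam1 : 0 < lam1) (hlam2 : 0 < lam2)
    (βh : ℕ → ({b : Fin p // b ≠ a} → ℝ))
    (hmin : ∀ γ : ℕ → ({b : Fin p // b ≠ a} → ℝ),
      tdLoss p n x a lam1 lam2 βh ≤ tdLoss p n x a lam1 lam2 γ)
    (z y : ℕ → ({b : Fin p // b ≠ a} → ℝ))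
    (hz1 : z 1 = 0) (hzn : z (n + 1) = 0)
    (hz : ∀ k ∈ Finset.Icc 2 n,
      (βh k ≠ βh (k - 1) →
        z k = (norm2 (βh k - βh (k - 1)))⁻¹ • (βh k - βh (k - 1))) ∧
      (βh k = βh (k - 1) → norm2 (z k) ≤ 1))
    (hy : ∀ i ∈ Finset.Icc 1 n, ∀ b : {b : Fin p // b ≠ a},
      (βh i b ≠ 0 → y i b = Real.sign (βh i b)) ∧
      (βh i b = 0 → |y i b| ≤ 1))
    (hstat : ∀ k ∈ Finset.Icc 1 n, ∀ b : {b : Fin p // b ≠ a},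
      (∑ i ∈ Finset.Icc k n, x i b.1 * ((∑ c, x i c.1 * βh i c) - x i a))
        + lam1 * z k b + lam2 * ∑ i ∈ Finset.Icc k n, y i b = 0)
    (hstrict : ∀ i ∈ Finset.Icc 1 n, ∀ b : {b : Fin p // b ≠ a},
      βh i b = 0 → |y i b| < 1) :
    ∀ βt : ℕ → ({b : Fin p // b ≠ a} → ℝ),
      (∀ γ : ℕ → ({b : Fin p // b ≠ a} → ℝ),
        tdLoss p n x a lam1 lam2 βt ≤ tdLoss p n x a lam1 lam2 γ) →
      boundarySet p n a βt = boundarySet p n a βh →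
      ∀ i ∈ Finset.Icc 1 n, ∀ b : {b : Fin p // b ≠ a},
        βh i b = 0 → βt i b = 0 := by
  intro βt hmint _ i0 hi0 b0 hb0
  have hle := hmint βh
  -- pointwise stationarity
  have hst : ∀ k ∈ Finset.Icc 1 n, ∀ b : {b : Fin p // b ≠ a},
      x k b.1 * ((∑ c, x k c.1 * βh k c) - x k a)
        + lam1 * (z k b - z (k + 1) b) + lam2 * y k b = 0 := by
    intro k hk b
    have hk' := Finset.mem_Icc.mp hk
    have h1 := hstat k hk b
    rw [← Finset.add_sum_Ioc_eq_sum_Icc hk'.2, ← Finset.add_sum_Ioc_eq_sum_Icc hk'.2] at h1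
    have hI : Finset.Ioc k n = Finset.Icc (k + 1) n := by ext j; simp only [Finset.mem_Ioc, Finset.mem_Icc]; omega
    rw [hI] at h1
    rcases Nat.lt_or_ge k n with hlt | hge
    · have h2 := hstat (k + 1) (Finset.mem_Icc.mpr ⟨by omega, hlt⟩) b
      linarith
    · have hkn : k = n := le_antisymm hk'.2 hge
      subst hkn
      rw [hzn]
      simp only [Nat.lt_succ_self, Finset.Icc_eq_empty_of_lt, Finset.sum_empty, Pi.zero_apply] at h1 ⊢
      linarith
  -- summation by parts
  have habel : ∑ k ∈ Finset.Icc 1 n, ∑ b, (z k b - z (k + 1) b) * (βt k b - βh k b)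
      = ∑ k ∈ Finset.Icc 2 n, ∑ b, z k b * ((βt k b - βh k b) - (βt (k - 1) b - βh (k - 1) b)) := by
    rw [Finset.sum_comm, Finset.sum_comm (s := Finset.Icc 2 n)]
    refine Finset.sum_congr rfl fun b _ => ?_
    have h := aux_abel (fun k => z k b) (fun k => βt k b - βh k b) n hn
    simp only [hz1, hzn, Pi.zero_apply] at h
    linarith
  have hsum : ∑ k ∈ Finset.Icc 1 n, ((∑ c, x k c.1 * βh k c) - x k a)
        * ((∑ c, x k c.1 * βt k c) - ∑ c, x k c.1 * βh k c)
      + lam1 * ∑ k ∈ Finset.Icc 1 n, ∑ b, (z k b - z (k + 1) b) * (βt k b - βh k b)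
      + lam2 * ∑ k ∈ Finset.Icc 1 n, ∑ b, y k b * (βt k b - βh k b) = 0 := by
    rw [Finset.mul_sum, Finset.mul_sum, ← Finset.sum_add_distrib, ← Finset.sum_add_distrib]
    refine Finset.sum_eq_zero fun k hk => ?_
    rw [← Finset.sum_sub_distrib, Finset.mul_sum, Finset.mul_sum, Finset.mul_sum,
      ← Finset.sum_add_distrib, ← Finset.sum_add_distrib]
    refine Finset.sum_eq_zero fun b _ => ?_
    have h := hst k hk b
    linear_combination (βt k b - βh k b) * h
  -- quadratic part
  have hquad : ∑ k ∈ Finset.Icc 1 n, (x k a - ∑ b, x k b.1 * βh k b) ^ 2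
      + 2 * ∑ k ∈ Finset.Icc 1 n, ((∑ c, x k c.1 * βh k c) - x k a)
        * ((∑ c, x k c.1 * βt k c) - ∑ c, x k c.1 * βh k c)
      ≤ ∑ k ∈ Finset.Icc 1 n, (x k a - ∑ b, x k b.1 * βt k b) ^ 2 := by
    rw [Finset.mul_sum, ← Finset.sum_add_distrib]
    refine Finset.sum_le_sum fun k _ => ?_
    nlinarith [sq_nonneg ((∑ c, x k c.1 * βt k c) - ∑ c, x k c.1 * βh k c)]
  -- group norm part
  have hgrp : ∑ k ∈ Finset.Icc 2 n, norm2 (βh k - βh (k - 1))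
      + ∑ k ∈ Finset.Icc 2 n, ∑ b, z k b * ((βt k b - βh k b) - (βt (k - 1) b - βh (k - 1) b))
      ≤ ∑ k ∈ Finset.Icc 2 n, norm2 (βt k - βt (k - 1)) := by
    rw [← Finset.sum_add_distrib]
    refine Finset.sum_le_sum fun k hk => ?_
    have hzz : norm2 (z k) ≤ 1 ∧
        ∑ b, z k b * (βh k - βh (k - 1)) b = norm2 (βh k - βh (k - 1)) := by
      by_cases hne : βh k = βh (k - 1)
      · refine ⟨(hz k hk).2 hne, ?_⟩
        rw [sub_eq_zero.mpr hne]
        simp [norm2]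
      · rw [(hz k hk).1 hne]
        exact aux_normalized _ (sub_ne_zero.mpr hne)
    have h1 := aux_cs (z k) (βt k - βt (k - 1)) hzz.1
    rw [← hzz.2, ← Finset.sum_add_distrib]
    refine le_trans (le_of_eq ?_) h1
    refine Finset.sum_congr rfl fun b _ => ?_
    simp only [Pi.sub_apply]
    ring
  -- l1 part
  have hpt : ∀ k ∈ Finset.Icc 1 n, ∀ b : {b : Fin p // b ≠ a},
      |βh k b| + y k b * (βt k b - βh k b) ≤ |βt k b| := by
    intro k hk b
    have hyy : |y k b| ≤ 1 ∧ y k b * βh k b = |βh k b| := by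
      by_cases hne : βh k b = 0
      · exact ⟨(hy k hk b).2 hne, by simp [hne]⟩
      · rw [(hy k hk b).1 hne]
        rcases lt_or_gt_of_ne hne with h | h
        · rw [Real.sign_of_neg h, abs_of_neg h]; simp
        · rw [Real.sign_of_pos h, abs_of_pos h]; simp
    have h1 : y k b * βt k b ≤ |βt k b| := by
      calc y k b * βt k b ≤ |y k b * βt k b| := le_abs_self _
        _ = |y k b| * |βt k b| := abs_mul _ _
        _ ≤ |βt k b| := mul_le_of_le_one_left (abs_nonneg _) hyy.1
    linarith [hyy.2, mul_sub (y k b) (βt k b) (βh k b)]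
  by_contra hne
  have hstr : |βh i0 b0| + y i0 b0 * (βt i0 b0 - βh i0 b0) < |βt i0 b0| := by
    have hlt := hstrict i0 hi0 b0 hb0
    have hpos : 0 < |βt i0 b0| := abs_pos.mpr hne
    rw [hb0, abs_zero, zero_add, sub_zero]
    calc y i0 b0 * βt i0 b0 ≤ |y i0 b0 * βt i0 b0| := le_abs_self _
      _ = |y i0 b0| * |βt i0 b0| := abs_mul _ _
      _ < |βt i0 b0| := mul_lt_of_lt_one_left hpos hlt
  have hl1 : ∑ k ∈ Finset.Icc 1 n, ∑ b, |βh k b|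
      + ∑ k ∈ Finset.Icc 1 n, ∑ b, y k b * (βt k b - βh k b)
      < ∑ k ∈ Finset.Icc 1 n, ∑ b, |βt k b| := by
    rw [← Finset.sum_add_distrib]
    refine Finset.sum_lt_sum (fun k hk => ?_) ⟨i0, hi0, ?_⟩
    · rw [← Finset.sum_add_distrib]
      exact Finset.sum_le_sum fun b _ => hpt k hk b
    · rw [← Finset.sum_add_distrib]
      exact Finset.sum_lt_sum (fun b _ => hpt i0 hi0 b) ⟨b0, Finset.mem_univ _, hstr⟩
  unfold tdLoss at hle
  rw [habel] at hsum
  have hg' := mul_le_mul_of_nonneg_left hgrp hlam1.le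
  have hl' := mul_lt_mul_of_pos_left hl1 hlam2
  rw [mul_add] at hg' hl'
  linarith
end
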